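/- There exists an absolute constant C > 0 with the following property. Let Ω ⊆ ℝ² be open, p ∈ (1,∞), β > −1, and let v ∈ C^∞(Ω) satisfy Dv(x) ≠ 0 for every x ∈ Ω and |Dv|² Δv + (p − 2) Δ∞v = 0 at every point of Ω (the p-Laplace equation in nondivergence form). Then for every φ ∈ C_c^∞(Ω): ∫_Ω −det D[|Dv|^{β} Dv] φ² dx ≤ C ( 1 + 1/(1 + β) + β²/((p − 1)(β + 1)) ) ∫_Ω |Dv|^{2β+2} ( |φ| |D²φ| + |Dφ|² ) dx. -/

import Mathlib

open Real MeasureTheory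
open scoped RealInnerProductSpace

noncomputable section

/-- The Euclidean plane ℝ². -/
abbrev E2 : Type := EuclideanSpace ℝ (Fin 2)

/-- Standard basis vector. -/
def ee (i : Fin 2) : E2 := EuclideanSpace.single i (1 : ℝ)

/-- Partial derivative ∂ᵢf. -/
def pd (i : Fin 2) (f : E2 → ℝ) (x : E2) : ℝ := fderiv ℝ f x (ee i)

/-- Second partial derivative ∂ᵢ∂ⱼf. -/
def pd2 (i j : Fin 2) (f : E2 → ℝ) (x : E2) : ℝ := pd i (pd j f) x

/-- |Df|², squared Euclidean norm of the gradient. -/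
def gradSq (f : E2 → ℝ) (x : E2) : ℝ := (pd 0 f x) ^ 2 + (pd 1 f x) ^ 2

/-- |Df|, Euclidean norm of the gradient. -/
def gradNorm (f : E2 → ℝ) (x : E2) : ℝ := Real.sqrt (gradSq f x)

/-- Laplacian Δf = tr D²f. -/
def lap (f : E2 → ℝ) (x : E2) : ℝ := pd2 0 0 f x + pd2 1 1 f x

/-- ∞-Laplacian Δ∞f = D²f Df · Df. -/
def infLap (f : E2 → ℝ) (x : E2) : ℝ :=
  pd2 0 0 f x * pd 0 f x * pd 0 f x + pd2 0 1 f x * pd 0 f x * pd 1 f x +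
  pd2 1 0 f x * pd 1 f x * pd 0 f x + pd2 1 1 f x * pd 1 f x * pd 1 f x

/-- |D²f|², squared Frobenius norm of the Hessian. -/
def hessFrobSq (f : E2 → ℝ) (x : E2) : ℝ :=
  (pd2 0 0 f x) ^ 2 + (pd2 0 1 f x) ^ 2 + (pd2 1 0 f x) ^ 2 + (pd2 1 1 f x) ^ 2

/-- det D²f, determinant of the Hessian. -/
def detHess (f : E2 → ℝ) (x : E2) : ℝ :=
  pd2 0 0 f x * pd2 1 1 f x - pd2 0 1 f x * pd2 1 0 f x

/-- |D²f Df|². -/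
def hessGradSq (f : E2 → ℝ) (x : E2) : ℝ :=
  (pd2 0 0 f x * pd 0 f x + pd2 0 1 f x * pd 1 f x) ^ 2 +
  (pd2 1 0 f x * pd 0 f x + pd2 1 1 f x * pd 1 f x) ^ 2

/-- Jacobian determinant of the planar map with components `F 0`, `F 1`. -/
def jdet (F : Fin 2 → E2 → ℝ) (x : E2) : ℝ :=
  pd 0 (F 0) x * pd 1 (F 1) x - pd 1 (F 0) x * pd 0 (F 1) x

/-- Squared Frobenius norm of the Jacobian of the planar map with components `F 0`, `F 1`. -/
def jFrobSq (F : Fin 2 → E2 → ℝ) (x : E2) : ℝ :=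
  (pd 0 (F 0) x) ^ 2 + (pd 1 (F 0) x) ^ 2 + (pd 0 (F 1) x) ^ 2 + (pd 1 (F 1) x) ^ 2

/-- Df · Dg. -/
def gradDot (f g : E2 → ℝ) (x : E2) : ℝ :=
  pd 0 f x * pd 0 g x + pd 1 f x * pd 1 g x

/-- D²ψ Dv · Dv. -/
def hessQuad (ψ v : E2 → ℝ) (x : E2) : ℝ :=
  pd2 0 0 ψ x * pd 0 v x * pd 0 v x + pd2 0 1 ψ x * pd 0 v x * pd 1 v x +
  pd2 1 0 ψ x * pd 1 v x * pd 0 v x + pd2 1 1 ψ x * pd 1 v x * pd 1 v x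

/-- (D²v Dv) · Dψ. -/
def hessGradDot (v ψ : E2 → ℝ) (x : E2) : ℝ :=
  (pd2 0 0 v x * pd 0 v x + pd2 0 1 v x * pd 1 v x) * pd 0 ψ x +
  (pd2 1 0 v x * pd 0 v x + pd2 1 1 v x * pd 1 v x) * pd 1 ψ x

/-- Smooth compactly supported test function on Ω. -/
def IsTestOn (ψ : E2 → ℝ) (Ω : Set E2) : Prop :=
  ContDiff ℝ (⊤ : ℕ∞) ψ ∧ HasCompactSupport ψ ∧ tsupport ψ ⊆ Ω

/-- Components of W = |Dv|⁻¹ Dv. -/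
def Wcomp (v : E2 → ℝ) (i : Fin 2) : E2 → ℝ := fun y => (gradNorm v y)⁻¹ * pd i v y

/-! ### Pointwise algebra -/

lemma alg_det (β r r0 r1 v0 v1 a b c : ℝ) (hG : 0 < v0^2+v1^2)
    (h0 : r0 * (v0^2+v1^2) = β * r * (v0*a+v1*b))
    (h1 : r1 * (v0^2+v1^2) = β * r * (v0*b+v1*c)) :
    (r0*v0+r*a)*(r1*v1+r*c) - (r1*v0+r*b)*(r0*v1+r*b) = (1+β)*r^2*(a*c-b^2) := by
  have : (v0^2+v1^2) * ((r0*v0+r*a)*(r1*v1+r*c) - (r1*v0+r*b)*(r0*v1+r*b))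
      = (v0^2+v1^2) * ((1+β)*r^2*(a*c-b^2)) := by
    linear_combination r*(v0*c-v1*b)*h0 + r*(v1*a-v0*b)*h1
  exact mul_left_cancel₀ hG.ne' this

lemma alg_pde (p v0 v1 a b c I : ℝ) (hI : I = a*v0*v0 + b*v0*v1 + b*v1*v0 + c*v1*v1)
    (h : (v0^2+v1^2)*(a+c) + (p-2)*I = 0) :
    (p-1)*I^2 ≤ -(a*c-b^2)*(v0^2+v1^2)^2 := by
  have e : -(a*c-b^2)*(v0^2+v1^2)^2 - (p-1)*I^2
      = ((v0*a+v1*b)*v1-(v0*b+v1*c)*v0)^2 := by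
    have : -(a*c-b^2)*(v0^2+v1^2)^2 = (p-2)*I^2
      + (v0^2+v1^2)*((v0*a+v1*b)^2+(v0*b+v1*c)^2) := by
      subst hI
      linear_combination (-(a*v0*v0 + b*v0*v1 + b*v1*v0 + c*v1*v1))*h
    rw [this, hI]; ring
  nlinarith [sq_nonneg ((v0*a+v1*b)*v1-(v0*b+v1*c)*v0)]

/-- the absorption estimate -/
lemma alg_young (β p v0 v1 I f f0 f1 G d : ℝ) (hp : 1 < p) (hβ : -1 < β) (hG : G = v0^2+v1^2)
    (hGp : 0 < G) (hd : (p-1)*I^2 ≤ d*G^2) :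
    -2*β*(I/G)*(f*(v0*f0+v1*f1)) ≤ (1+β)*d*f^2/2
      + 2*(β^2/((p-1)*(β+1)))*(G*(f0^2+f1^2)) := by
  have hq : 0 < (p-1)*(β+1) := mul_pos (by linarith) (by linarith)
  obtain ⟨i, hi⟩ : ∃ i, i = I/G := ⟨_, rfl⟩
  have hiI : I = i*G := by rw [hi]; field_simp
  rw [← hi]
  have hd' : (p-1)*i^2 ≤ d := by
    have : ((p-1)*i^2)*G^2 ≤ d*G^2 := by rw [hiI] at hd; linarith
    exact le_of_mul_le_mul_right this (by positivity)
  have h1 : ((p-1)*(β+1))*i^2*f^2 ≤ (1+β)*d*f^2 := by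
    have := mul_le_mul_of_nonneg_left hd' (show 0 ≤ (β+1)*f^2 by
      have : 0 < β+1 := by linarith
      positivity)
    nlinarith
  have hcs : (v0*f0+v1*f1)^2 ≤ G*(f0^2+f1^2) := by
    rw [hG]; nlinarith [sq_nonneg (v0*f1-v1*f0)]
  obtain ⟨q, hqq⟩ : ∃ q, q = (p-1)*(β+1) := ⟨_, rfl⟩
  rw [← hqq] at hq h1 ⊢
  have h2 : 2*(β^2/q)*(v0*f0+v1*f1)^2 ≤ 2*(β^2/q)*(G*(f0^2+f1^2)) :=
    mul_le_mul_of_nonneg_left hcs (by positivity)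
  have h3 : -2*β*i*(f*(v0*f0+v1*f1)) ≤ q*i^2*f^2/2 + 2*(β^2/q)*(v0*f0+v1*f1)^2 := by
    have : q*i^2*f^2/2 + 2*(β^2/q)*(v0*f0+v1*f1)^2 + 2*β*i*(f*(v0*f0+v1*f1))
      = (q*i*f+2*β*(v0*f0+v1*f1))^2/(2*q) := by
      field_simp; ring
    have h4 : 0 ≤ (q*i*f+2*β*(v0*f0+v1*f1))^2/(2*q) := by positivity
    linarith
  linarith

lemma alg_hess (v0 v1 f f0 f1 k00 k01 k10 k11 N : ℝ) (hN0 : 0 ≤ N)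
    (hN : N^2 = k00^2+k01^2+k10^2+k11^2) :
    -(f*(k00*v0*v0+k01*v0*v1+k10*v1*v0+k11*v1*v1) + (v0*f0+v1*f1)^2)
      ≤ (v0^2+v1^2)*(|f| * N) := by
  have h : |k00*v0*v0+k01*v0*v1+k10*v1*v0+k11*v1*v1| ≤ (v0^2+v1^2)*N := by
    apply abs_le_of_sq_le_sq _ (by positivity)
    rw [mul_pow, hN]
    nlinarith [sq_nonneg (k00*(v0*v1)-k01*(v0*v0)), sq_nonneg (k00*(v1*v0)-k10*(v0*v0)),
      sq_nonneg (k00*(v1*v1)-k11*(v0*v0)), sq_nonneg (k01*(v1*v0)-k10*(v0*v1)),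
      sq_nonneg (k01*(v1*v1)-k11*(v0*v1)), sq_nonneg (k10*(v1*v1)-k11*(v1*v0))]
  have h2 := neg_abs_le (f*(k00*v0*v0+k01*v0*v1+k10*v1*v0+k11*v1*v1))
  rw [abs_mul] at h2
  have h3 := mul_le_mul_of_nonneg_left h (abs_nonneg f)
  nlinarith [sq_nonneg (v0*f0+v1*f1)]

lemma alg_lap (f f0 f1 k00 k01 k10 k11 N : ℝ) (hN0 : 0 ≤ N)
    (hN : N^2 = k00^2+k01^2+k10^2+k11^2) :
    f*(k00+k11) + (f0^2+f1^2) ≤ 2*(|f| * N + (f0^2+f1^2)) := by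
  have h : |k00+k11| ≤ 2*N := by
    apply abs_le_of_sq_le_sq _ (by positivity)
    nlinarith [sq_nonneg (k00-k11), sq_nonneg k01, sq_nonneg k10, sq_nonneg k00, sq_nonneg k11]
  have h2 := le_abs_self (f*(k00+k11))
  rw [abs_mul] at h2
  have h3 := mul_le_mul_of_nonneg_left h (abs_nonneg f)
  nlinarith [sq_nonneg f0, sq_nonneg f1]

/-- The divergence identity. -/
lemma alg_key (β r r0 r1 v0 v1 a b c t0 t1 f f0 f1 k00 k01 k10 k11 D0 D1 m i : ℝ)
    (hG : 0 < v0^2+v1^2)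
    (h0 : r0 * (v0^2+v1^2) = β * r * (v0*a+v1*b))
    (h1 : r1 * (v0^2+v1^2) = β * r * (v0*b+v1*c))
    (hm : m*(1+β) = 1) (hi : i*(v0^2+v1^2) = a*v0*v0 + b*v0*v1 + b*v1*v0 + c*v1*v1)
    (hD0 : D0 = f0*(r*r*(-(f/2)*(c*v0-b*v1)+v0*(v0*f0+v1*f1)-(v0*v0+v1*v1)*f0*m))
      + f*((r0*r+r*r0)*(-(f/2)*(c*v0-b*v1)+v0*(v0*f0+v1*f1)-(v0*v0+v1*v1)*f0*m)
        + r*r*(-(f0/2)*(c*v0-b*v1) - (f/2)*(t0*v0+c*a-(t1*v1+b*b))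
          + (a*(v0*f0+v1*f1)+v0*(a*f0+v0*k00+(b*f1+v1*k01)))
          - ((a*v0+v0*a+(b*v1+v1*b))*f0+(v0*v0+v1*v1)*k00)*m)))
    (hD1 : D1 = f1*(r*r*(-(f/2)*(a*v1-b*v0)+v1*(v0*f0+v1*f1)-(v0*v0+v1*v1)*f1*m))
      + f*((r1*r+r*r1)*(-(f/2)*(a*v1-b*v0)+v1*(v0*f0+v1*f1)-(v0*v0+v1*v1)*f1*m)
        + r*r*(-(f1/2)*(a*v1-b*v0) - (f/2)*(t1*v1+a*c-(t0*v0+b*b))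
          + (c*(v0*f0+v1*f1)+v1*(b*f0+v0*k10+(c*f1+v1*k11)))
          - ((b*v0+v0*b+(c*v1+v1*c))*f1+(v0*v0+v1*v1)*k11)*m))) :
    (-((1+β)*r^2*(a*c-b^2)))*f^2 = D0 + D1 + r^2*(-2*β*i*(f*(v0*f0+v1*f1)))
      + r^2*(v0^2+v1^2)*m*(f*(k00+k11) + (f0^2+f1^2))
      + r^2*(-(f*(k00*v0*v0+k01*v0*v1+k10*v1*v0+k11*v1*v1) + (v0*f0+v1*f1)^2)) := by
  apply mul_left_cancel₀ hG.ne'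
  rw [hD0, hD1]
  linear_combination
    (-2*f*r*(-(f/2)*(c*v0-b*v1)+v0*(v0*f0+v1*f1)-(v0*v0+v1*v1)*f0*m))*h0
    + (-2*f*r*(-(f/2)*(a*v1-b*v0)+v1*(v0*f0+v1*f1)-(v0*v0+v1*v1)*f1*m))*h1
    + (2*f*r^2*(v0^2+v1^2)*((v0*a+v1*b)*f0+(v0*b+v1*c)*f1))*hm
    + (2*β*r^2*f*(v0*f0+v1*f1))*hi

/-- The divergence identity plus estimates. -/
lemma alg_main (β p r r0 r1 v0 v1 a b c t0 t1 f f0 f1 k00 k01 k10 k11 N D0 D1 : ℝ)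
    (hp : 1 < p) (hβ : -1 < β) (hG : 0 < v0^2+v1^2)
    (h0 : r0 * (v0^2+v1^2) = β * r * (v0*a+v1*b))
    (h1 : r1 * (v0^2+v1^2) = β * r * (v0*b+v1*c))
    (hpde : (v0^2+v1^2)*(a+c) + (p-2)*(a*v0*v0 + b*v0*v1 + b*v1*v0 + c*v1*v1) = 0)
    (hN0 : 0 ≤ N) (hN : N^2 = k00^2+k01^2+k10^2+k11^2)
    (hD0 : D0 = f0*(r*r*(-(f/2)*(c*v0-b*v1)+v0*(v0*f0+v1*f1)-(v0*v0+v1*v1)*f0/(1+β)))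
      + f*((r0*r+r*r0)*(-(f/2)*(c*v0-b*v1)+v0*(v0*f0+v1*f1)-(v0*v0+v1*v1)*f0/(1+β))
        + r*r*(-(f0/2)*(c*v0-b*v1) - (f/2)*(t0*v0+c*a-(t1*v1+b*b))
          + (a*(v0*f0+v1*f1)+v0*(a*f0+v0*k00+(b*f1+v1*k01)))
          - ((a*v0+v0*a+(b*v1+v1*b))*f0+(v0*v0+v1*v1)*k00)/(1+β))))
    (hD1 : D1 = f1*(r*r*(-(f/2)*(a*v1-b*v0)+v1*(v0*f0+v1*f1)-(v0*v0+v1*v1)*f1/(1+β)))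
      + f*((r1*r+r*r1)*(-(f/2)*(a*v1-b*v0)+v1*(v0*f0+v1*f1)-(v0*v0+v1*v1)*f1/(1+β))
        + r*r*(-(f1/2)*(a*v1-b*v0) - (f/2)*(t1*v1+a*c-(t0*v0+b*b))
          + (c*(v0*f0+v1*f1)+v1*(b*f0+v0*k10+(c*f1+v1*k11)))
          - ((b*v0+v0*b+(c*v1+v1*c))*f1+(v0*v0+v1*v1)*k11)/(1+β)))) :
    (-((r0*v0+r*a)*(r1*v1+r*c) - (r1*v0+r*b)*(r0*v1+r*b))) * f^2
      ≤ 2*(D0+D1) + 4 * (1 + 1/(1 + β) + β^2/((p - 1) * (β + 1))) *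
        (r^2*(v0^2+v1^2)*(|f| * N+(f0^2+f1^2))) := by
  rw [alg_det β r r0 r1 v0 v1 a b c hG h0 h1]
  obtain ⟨I, hI⟩ : ∃ I, I = a*v0*v0 + b*v0*v1 + b*v1*v0 + c*v1*v1 := ⟨_, rfl⟩
  rw [← hI] at hpde
  obtain ⟨G, hGG⟩ : ∃ G, G = v0^2+v1^2 := ⟨_, rfl⟩
  have hd := alg_pde p v0 v1 a b c I hI hpde
  rw [← hGG] at hd hG
  have Y := alg_young β p v0 v1 I f f0 f1 G _ hp hβ hGG hG hd
  have H := alg_hess v0 v1 f f0 f1 k00 k01 k10 k11 N hN0 hN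
  have L := alg_lap f f0 f1 k00 k01 k10 k11 N hN0 hN
  have hb : 0 < 1+β := by linarith
  obtain ⟨m, hm⟩ : ∃ m, m = 1/(1+β) := ⟨_, rfl⟩
  have hm1 : m*(1+β) = 1 := by rw [hm]; field_simp
  have hm0 : 0 < m := by rw [hm]; positivity
  obtain ⟨i, hi⟩ : ∃ i, i = I/G := ⟨_, rfl⟩
  have hi1 : i*G = I := by rw [hi]; field_simp
  rw [← hi] at Y
  have key := alg_key β r r0 r1 v0 v1 a b c t0 t1 f f0 f1 k00 k01 k10 k11 D0 D1 m i
    (by rw [← hGG]; exact hG) h0 h1 hm1 (by rw [← hGG, hi1, hI]) (by rw [hD0, hm]; ring) (by rw [hD1, hm]; ring)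
  rw [← hm]
  have Y' := mul_le_mul_of_nonneg_left Y (sq_nonneg r)
  have H' := mul_le_mul_of_nonneg_left H (sq_nonneg r)
  have L' := mul_le_mul_of_nonneg_left L (show 0 ≤ r^2*G*m by positivity)
  rw [← hGG] at H' key ⊢
  have hK : 0 ≤ β^2/((p - 1) * (β + 1)) := by
    have : 0 < p - 1 := by linarith
    have : 0 < β + 1 := by linarith
    positivity
  obtain ⟨K, hKK⟩ : ∃ K, K = β^2/((p - 1) * (β + 1)) := ⟨_, rfl⟩
  rw [← hKK] at hK Y' ⊢
  have P1 : 0 ≤ r^2*G*(|f| * N) := by positivity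
  have P2 : 0 ≤ r^2*G*(f0^2+f1^2) := by positivity
  have P3 := mul_nonneg hK P1
  have P4 := mul_nonneg hm0.le P1
  have P5 := mul_nonneg hm0.le P2
  clear hD0 hD1 hd h0 h1 hpde hN Y H L
  linarith

/-! ### Calculus of partial derivatives -/

lemma pd_mul {f g : E2 → ℝ} {x : E2} (i : Fin 2) (hf : DifferentiableAt ℝ f x)
    (hg : DifferentiableAt ℝ g x) :
    pd i (fun y => f y * g y) x = pd i f x * g x + f x * pd i g x := by
  unfold pd
  rw [fderiv_fun_mul hf hg]
  simp; ring

lemma pd_add {f g : E2 → ℝ} {x : E2} (i : Fin 2) (hf : DifferentiableAt ℝ f x)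
    (hg : DifferentiableAt ℝ g x) :
    pd i (fun y => f y + g y) x = pd i f x + pd i g x := by
  unfold pd
  rw [fderiv_fun_add hf hg]
  simp

lemma pd_sub {f g : E2 → ℝ} {x : E2} (i : Fin 2) (hf : DifferentiableAt ℝ f x)
    (hg : DifferentiableAt ℝ g x) :
    pd i (fun y => f y - g y) x = pd i f x - pd i g x := by
  unfold pd
  rw [fderiv_fun_sub hf hg]
  simp

lemma pd_neg {f : E2 → ℝ} {x : E2} (i : Fin 2) :
    pd i (fun y => - f y) x = - pd i f x := by
  unfold pd
  rw [fderiv_fun_neg]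
  simp

lemma pd_div_const {f : E2 → ℝ} {x : E2} (i : Fin 2) (c : ℝ) (hf : DifferentiableAt ℝ f x) :
    pd i (fun y => f y / c) x = pd i f x / c := by
  unfold pd
  simp only [div_eq_mul_inv]
  rw [fderiv_mul_const hf]
  simp; ring

lemma pd_rpow {f : E2 → ℝ} {x : E2} (i : Fin 2) (c : ℝ) (hf : DifferentiableAt ℝ f x)
    (h : 0 < f x) :
    pd i (fun y => f y ^ c) x * f x = c * f x ^ c * pd i f x := by
  unfold pd
  rw [(hf.hasFDerivAt.rpow_const (p := c) (Or.inl h.ne')).fderiv]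
  rw [Real.rpow_sub_one h.ne']
  simp; field_simp

lemma pd_comm {f : E2 → ℝ} {x : E2} (i j : Fin 2) (hf : ContDiffAt ℝ (⊤ : ℕ∞) f x) :
    pd i (pd j f) x = pd j (pd i f) x := by
  have hs : IsSymmSndFDerivAt ℝ f x := hf.isSymmSndFDerivAt (by
    simp only [minSmoothness_of_isRCLikeNormedField]
    exact WithTop.coe_le_coe.mpr le_top)
  have hd : DifferentiableAt ℝ (fderiv ℝ f) x :=
    (hf.fderiv_right (m := 1) (WithTop.coe_le_coe.mpr le_top)).differentiableAt (by simp)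
  have e : ∀ i j : Fin 2, pd i (pd j f) x = fderiv ℝ (fderiv ℝ f) x (ee i) (ee j) := by
    intro i j
    unfold pd
    rw [fderiv_clm_apply hd (differentiableAt_const _)]
    simp
  rw [e, e]
  exact hs _ _

lemma cd_pd {f : E2 → ℝ} {x : E2} (i : Fin 2) (hf : ContDiffAt ℝ (⊤ : ℕ∞) f x) :
    ContDiffAt ℝ (⊤ : ℕ∞) (pd i f) x := by
  unfold pd
  exact (hf.fderiv_right (m := (⊤ : ℕ∞)) (by exact_mod_cast le_top)).clm_apply contDiffAt_const

lemma cd_da {f : E2 → ℝ} {x : E2} (hf : ContDiffAt ℝ (⊤ : ℕ∞) f x) : DifferentiableAt ℝ f x :=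
  hf.differentiableAt (by simp)

/-! ### Test functions and integration -/

lemma prod_smooth {Ω : Set E2} {φ Y : E2 → ℝ} (hφ : IsTestOn φ Ω)
    (hY : ∀ x ∈ Ω, ContDiffAt ℝ (⊤ : ℕ∞) Y x) :
    ContDiff ℝ (⊤ : ℕ∞) (fun y => φ y * Y y) := by
  rw [contDiff_iff_contDiffAt]
  intro x
  by_cases hx : x ∈ Ω
  · exact hφ.1.contDiffAt.mul (hY x hx)
  · have h := notMem_tsupport_iff_eventuallyEq.mp (fun h => hx (hφ.2.2 h))
    have h2 : (fun y => φ y * Y y) =ᶠ[nhds x] fun _ => 0 := by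
      filter_upwards [h] with y hy
      simp [hy]
    exact contDiffAt_const.congr_of_eventuallyEq h2

lemma int_pd_zero {g : E2 → ℝ} (i : Fin 2) (hg : ContDiff ℝ (⊤ : ℕ∞) g)
    (hc : HasCompactSupport g) : Integrable (pd i g) ∧ ∫ x, pd i g x = 0 := by
  have hd : Integrable (pd i g) := by
    apply Continuous.integrable_of_hasCompactSupport
    · unfold pd
      exact (hg.continuous_fderiv (by simp)).clm_apply continuous_const
    · exact hc.fderiv_apply ℝ _
  refine ⟨hd, ?_⟩
  have hd' : Integrable (fun x => fderiv ℝ g x (ee i)) := hd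
  have := integral_mul_fderiv_eq_neg_fderiv_mul_of_integrable (𝕜 := ℝ) (μ := (volume : Measure E2))
    (f := fun _ => (1:ℝ)) (g := g) (v := ee i) (by simp) (by simpa [pd, Function.comp_def] using hd')
    (by simpa using hg.continuous.integrable_of_hasCompactSupport hc)
    (fun _ _ => differentiableAt_const _) (fun x _ => (hg.differentiable (by simp)) x)
  simpa [pd] using this

lemma int_prod {Ω : Set E2} {φ g Y : E2 → ℝ} (hφ : IsTestOn φ Ω) (hg : Continuous g)
    (hg0 : ∀ x, x ∉ tsupport φ → g x = 0)
    (hY : ∀ x ∈ Ω, ContinuousAt Y x) : Integrable (fun y => Y y * g y) := by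
  apply Continuous.integrable_of_hasCompactSupport
  · rw [continuous_iff_continuousAt]
    intro x
    by_cases hx : x ∈ Ω
    · exact (hY x hx).mul hg.continuousAt
    · have hx' : x ∈ (tsupport φ)ᶜ := fun h => hx (hφ.2.2 h)
      have h2 : (fun y => Y y * g y) =ᶠ[nhds x] fun _ => 0 := by
        filter_upwards [(isClosed_tsupport φ).isOpen_compl.mem_nhds hx'] with y hy
        simp [hg0 y hy]
      exact continuousAt_const.congr h2.symm
  · refine HasCompactSupport.intro hφ.2.1 (fun x hx => ?_)
    simp [hg0 x hx]

lemma pd_off {φ : E2 → ℝ} (Y : E2 → ℝ) (i : Fin 2) {x : E2} (hx : x ∉ tsupport φ) :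
    pd i (fun y => φ y * Y y) x = 0 := by
  have h := notMem_tsupport_iff_eventuallyEq.mp hx
  have h2 : (fun y => φ y * Y y) =ᶠ[nhds x] fun _ => (0:ℝ) := by
    filter_upwards [h] with y hy
    simp [hy]
  unfold pd
  rw [h2.fderiv_eq]; simp

lemma div_zero_int {Ω : Set E2} {φ Y : E2 → ℝ} (i : Fin 2) (hφ : IsTestOn φ Ω)
    (hY : ∀ x ∈ Ω, ContDiffAt ℝ (⊤ : ℕ∞) Y x) :
    Integrable (pd i (fun y => φ y * Y y)) ∧ ∫ x in Ω, pd i (fun y => φ y * Y y) x = 0 := by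
  have h := int_pd_zero i (prod_smooth hφ hY) hφ.2.1.mul_right
  refine ⟨h.1, ?_⟩
  rw [setIntegral_eq_integral_of_forall_compl_eq_zero, h.2]
  intro x hx
  exact pd_off Y i (fun h => hx (hφ.2.2 h))

/-- `|Dv|^β` as a power of the squared gradient. -/
def rr (v : E2 → ℝ) (β : ℝ) (y : E2) : ℝ :=
  (pd 0 v y * pd 0 v y + pd 1 v y * pd 1 v y) ^ (β/2)

lemma gradNorm_rpow (v : E2 → ℝ) (β : ℝ) (y : E2) : gradNorm v y ^ β = rr v β y := by
  unfold gradNorm rr gradSq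
  rw [Real.sqrt_eq_rpow, ← Real.rpow_mul (by positivity)]
  congr 1
  · ring
  · ring

/-- first component of the compactly supported field, divided by φ -/
def Y0 (v φ : E2 → ℝ) (β : ℝ) (y : E2) : ℝ :=
  rr v β y * rr v β y * (-(φ y/2)*(pd 1 (pd 1 v) y*pd 0 v y-pd 1 (pd 0 v) y*pd 1 v y)
    +pd 0 v y*(pd 0 v y*pd 0 φ y+pd 1 v y*pd 1 φ y)
    -(pd 0 v y*pd 0 v y+pd 1 v y*pd 1 v y)*pd 0 φ y/(1+β))

/-- second component of the compactly supported field, divided by φ -/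
def Y1 (v φ : E2 → ℝ) (β : ℝ) (y : E2) : ℝ :=
  rr v β y * rr v β y * (-(φ y/2)*(pd 0 (pd 0 v) y*pd 1 v y-pd 0 (pd 1 v) y*pd 0 v y)
    +pd 1 v y*(pd 0 v y*pd 0 φ y+pd 1 v y*pd 1 φ y)
    -(pd 0 v y*pd 0 v y+pd 1 v y*pd 1 v y)*pd 1 φ y/(1+β))

lemma cd_rr {v : E2 → ℝ} {x : E2} (β : ℝ) (hv : ContDiffAt ℝ (⊤ : ℕ∞) v x)
    (h : gradSq v x ≠ 0) : ContDiffAt ℝ (⊤ : ℕ∞) (rr v β) x := by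
  unfold rr
  have h0 := cd_pd 0 hv
  have h1 := cd_pd 1 hv
  refine ContDiffAt.rpow_const_of_ne ((h0.mul h0).add (h1.mul h1)) ?_
  simpa [gradSq, sq] using h

lemma cd_Y0 {v φ : E2 → ℝ} {x : E2} (β : ℝ) (hv : ContDiffAt ℝ (⊤ : ℕ∞) v x)
    (h : gradSq v x ≠ 0) (hφ : ContDiffAt ℝ (⊤ : ℕ∞) φ x) :
    ContDiffAt ℝ (⊤ : ℕ∞) (Y0 v φ β) x := by
  have hr := cd_rr β hv h
  have h0 := cd_pd 0 hv
  have h1 := cd_pd 1 hv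
  have h11 := cd_pd 1 h1
  have h10 := cd_pd 1 h0
  have k0 := cd_pd 0 hφ
  have k1 := cd_pd 1 hφ
  unfold Y0
  fun_prop

lemma cd_Y1 {v φ : E2 → ℝ} {x : E2} (β : ℝ) (hv : ContDiffAt ℝ (⊤ : ℕ∞) v x)
    (h : gradSq v x ≠ 0) (hφ : ContDiffAt ℝ (⊤ : ℕ∞) φ x) :
    ContDiffAt ℝ (⊤ : ℕ∞) (Y1 v φ β) x := by
  have hr := cd_rr β hv h
  have h0 := cd_pd 0 hv
  have h1 := cd_pd 1 hv
  have h00 := cd_pd 0 h0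
  have h01 := cd_pd 0 h1
  have k0 := cd_pd 0 hφ
  have k1 := cd_pd 1 hφ
  unfold Y1
  fun_prop

lemma pd_rr {v : E2 → ℝ} {x : E2} (β : ℝ) (i : Fin 2) (hv : ContDiffAt ℝ (⊤ : ℕ∞) v x)
    (h : gradSq v x ≠ 0) : pd i (rr v β) x * (pd 0 v x ^ 2 + pd 1 v x ^ 2)
      = β * rr v β x * (pd 0 v x * pd i (pd 0 v) x + pd 1 v x * pd i (pd 1 v) x) := by
  have h0 := cd_da (cd_pd 0 hv)
  have h1 := cd_da (cd_pd 1 hv)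
  have hpos : 0 < pd 0 v x * pd 0 v x + pd 1 v x * pd 1 v x := by
    refine lt_of_le_of_ne (by nlinarith [sq_nonneg (pd 0 v x), sq_nonneg (pd 1 v x)]) (Ne.symm ?_)
    simpa [gradSq, sq] using h
  have := pd_rpow (f := fun y => pd 0 v y * pd 0 v y + pd 1 v y * pd 1 v y) i (β/2)
    (by fun_prop) hpos
  rw [pd_add i (by fun_prop) (by fun_prop), pd_mul i h0 h0, pd_mul i h1 h1] at this
  have e : pd i (rr v β) x = pd i
    (fun y => (pd 0 v y * pd 0 v y + pd 1 v y * pd 1 v y) ^ (β/2)) x := rfl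
  have e2 : rr v β x = (pd 0 v x * pd 0 v x + pd 1 v x * pd 1 v x) ^ (β/2) := rfl
  rw [e, e2]
  linear_combination this

lemma pointwise {v φ : E2 → ℝ} {x : E2} (β p : ℝ) (hp : 1 < p) (hβ : -1 < β)
    (hv : ContDiffAt ℝ (⊤ : ℕ∞) v x)
    (h : gradSq v x ≠ 0) (hφ : ContDiffAt ℝ (⊤ : ℕ∞) φ x)
    (hpde : gradSq v x * lap v x + (p - 2) * infLap v x = 0) :
    (-jdet (fun i y => gradNorm v y ^ β * pd i v y) x) * (φ x) ^ 2 ≤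
      2 * (pd 0 (fun y => φ y * Y0 v φ β y) x + pd 1 (fun y => φ y * Y1 v φ β y) x)
      + 4 * (1 + 1/(1 + β) + β^2/((p - 1) * (β + 1))) *
        (gradNorm v x ^ (2*β + 2) * (|φ x| * Real.sqrt (hessFrobSq φ x) + gradSq φ x)) := by
  have hrc := cd_rr β hv h
  have hr := cd_da hrc
  have h0 := cd_da (cd_pd 0 hv)
  have h1 := cd_da (cd_pd 1 hv)
  have h00 := cd_da (cd_pd 0 (cd_pd 0 hv))
  have h01 := cd_da (cd_pd 0 (cd_pd 1 hv))
  have h10 := cd_da (cd_pd 1 (cd_pd 0 hv))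
  have h11 := cd_da (cd_pd 1 (cd_pd 1 hv))
  have k := cd_da hφ
  have k0 := cd_da (cd_pd 0 hφ)
  have k1 := cd_da (cd_pd 1 hφ)
  have hpos : 0 < pd 0 v x ^ 2 + pd 1 v x ^ 2 :=
    lt_of_le_of_ne (by positivity) (Ne.symm h)
  have sy : pd 1 (pd 0 v) x = pd 0 (pd 1 v) x := pd_comm 1 0 hv
  have sy0 : pd 0 (pd 1 (pd 0 v)) x = pd 1 (pd 0 (pd 0 v)) x := pd_comm 0 1 (cd_pd 0 hv)
  have sy1 : pd 1 (pd 0 (pd 1 v)) x = pd 0 (pd 1 (pd 1 v)) x := pd_comm 1 0 (cd_pd 1 hv)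
  have eF : (fun (i : Fin 2) y => gradNorm v y ^ β * pd i v y)
      = fun i y => rr v β y * pd i v y := by
    funext i y; rw [gradNorm_rpow]
  have eH : gradNorm v x ^ (2*β+2) = rr v β x ^ 2 * (pd 0 v x ^ 2 + pd 1 v x ^ 2) := by
    have hn : 0 < gradNorm v x := Real.sqrt_pos.mpr hpos
    rw [← gradNorm_rpow, Real.rpow_add hn, mul_comm 2 β, Real.rpow_mul hn.le]
    have : gradNorm v x ^ (2:ℝ) = pd 0 v x ^ 2 + pd 1 v x ^ 2 := by
      rw [Real.rpow_two]; exact Real.sq_sqrt hpos.le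
    rw [this, Real.rpow_two]
  have d0 := pd_rr β 0 hv h
  have d1 := pd_rr β 1 hv h
  rw [sy] at d1
  rw [eF, eH]
  have ej : jdet (fun i y => rr v β y * pd i v y) x =
    (pd 0 (rr v β) x * pd 0 v x + rr v β x * pd 0 (pd 0 v) x) *
    (pd 1 (rr v β) x * pd 1 v x + rr v β x * pd 1 (pd 1 v) x) -
    (pd 1 (rr v β) x * pd 0 v x + rr v β x * pd 0 (pd 1 v) x) *
    (pd 0 (rr v β) x * pd 1 v x + rr v β x * pd 0 (pd 1 v) x) := by
    unfold jdet
    rw [pd_mul 0 hr h0, pd_mul 1 hr h1, pd_mul 1 hr h0, pd_mul 0 hr h1, sy]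
  rw [ej]
  refine alg_main β p (rr v β x) _ _ (pd 0 v x) (pd 1 v x) _ _ _
    (pd 0 (pd 1 (pd 1 v)) x) (pd 1 (pd 0 (pd 0 v)) x)
    (φ x) (pd 0 φ x) (pd 1 φ x) (pd2 0 0 φ x) (pd2 0 1 φ x) (pd2 1 0 φ x) (pd2 1 1 φ x)
    (Real.sqrt (hessFrobSq φ x)) _ _ hp hβ hpos d0 d1 ?_ (Real.sqrt_nonneg _) ?_ ?_ ?_
  · simp only [gradSq, lap, infLap, pd2, sy] at hpde
    exact hpde
  · rw [Real.sq_sqrt]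
    · rfl
    · unfold hessFrobSq; positivity
  · unfold Y0 pd2
    simp (disch := fun_prop) only [pd_mul, pd_add, pd_sub, pd_neg, pd_div_const, sy, sy0, sy1]
    ring
  · unfold Y1 pd2
    simp (disch := fun_prop) only [pd_mul, pd_add, pd_sub, pd_neg, pd_div_const, sy, sy0, sy1]
    ring

lemma cont_pd {φ : E2 → ℝ} (i : Fin 2) (hφ : ContDiff ℝ (⊤ : ℕ∞) φ) :
    ContDiff ℝ (⊤ : ℕ∞) (pd i φ) := by
  rw [contDiff_iff_contDiffAt]
  exact fun x => cd_pd i hφ.contDiffAt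

lemma pd_zero_off {φ : E2 → ℝ} (i : Fin 2) {x : E2} (hx : x ∉ tsupport φ) : pd i φ x = 0 := by
  simpa using pd_off (φ := φ) (fun _ => 1) i hx

/-- uniform upper bound for ∫ −det D[|Dv|^β Dv] φ² for smooth
p-harmonic functions with nonvanishing gradient. -/
theorem stmt_16 : ∃ C : ℝ, 0 < C ∧
    ∀ (Ω : Set E2), IsOpen Ω → ∀ p : ℝ, 1 < p → ∀ β : ℝ, -1 < β →
    ∀ v : E2 → ℝ, ContDiffOn ℝ (⊤ : ℕ∞) v Ω →
    (∀ x ∈ Ω, gradSq v x ≠ 0) →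
    (∀ x ∈ Ω, gradSq v x * lap v x + (p - 2) * infLap v x = 0) →
    ∀ φ : E2 → ℝ, IsTestOn φ Ω →
    (∫ x in Ω, (-jdet (fun i y => gradNorm v y ^ β * pd i v y) x) * (φ x) ^ 2)
      ≤ C * (1 + 1/(1 + β) + β^2/((p - 1) * (β + 1))) *
          ∫ x in Ω, gradNorm v x ^ (2*β + 2)
            * (|φ x| * Real.sqrt (hessFrobSq φ x) + gradSq φ x) := by
  refine ⟨4, by norm_num, ?_⟩
  intro Ω hΩ p hp β hβ v hv hne hpde φ hφ
  have hvx : ∀ x ∈ Ω, ContDiffAt ℝ (⊤ : ℕ∞) v x := fun x hx => hv.contDiffAt (hΩ.mem_nhds hx)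
  have D0 := div_zero_int (Y := Y0 v φ β) 0 hφ
    (fun x hx => cd_Y0 β (hvx x hx) (hne x hx) hφ.1.contDiffAt)
  have D1 := div_zero_int (Y := Y1 v φ β) 1 hφ
    (fun x hx => cd_Y1 β (hvx x hx) (hne x hx) hφ.1.contDiffAt)
  have c0 := cont_pd 0 hφ.1
  have c1 := cont_pd 1 hφ.1
  have hH : Integrable (fun x => gradNorm v x ^ (2*β + 2)
            * (|φ x| * Real.sqrt (hessFrobSq φ x) + gradSq φ x)) := by
    refine int_prod hφ (g := fun x => |φ x| * Real.sqrt (hessFrobSq φ x) + gradSq φ x) ?_ ?_ ?_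
    · have a := hφ.1.continuous
      have a0 := c0.continuous
      have a1 := c1.continuous
      have a00 := (cont_pd 0 c0).continuous
      have a01 := (cont_pd 0 c1).continuous
      have a10 := (cont_pd 1 c0).continuous
      have a11 := (cont_pd 1 c1).continuous
      unfold hessFrobSq gradSq pd2
      fun_prop
    · intro x hx
      simp [gradSq, pd_zero_off _ hx, image_eq_zero_of_notMem_tsupport hx]
    · intro x hx
      have := (cd_rr (2*β+2) (hvx x hx) (hne x hx)).continuousAt
      have e : (fun x => gradNorm v x ^ (2*β+2)) = rr v (2*β+2) := by
        funext y; exact gradNorm_rpow _ _ _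
      rw [e]; exact this
  have hJ : Integrable (fun x =>
      (-jdet (fun i y => gradNorm v y ^ β * pd i v y) x) * (φ x) ^ 2) := by
    refine int_prod hφ (g := fun x => φ x ^ 2) (hφ.1.continuous.pow 2) ?_ ?_
    · intro x hx
      simp [image_eq_zero_of_notMem_tsupport hx]
    · intro x hx
      have eF : (fun (i : Fin 2) y => gradNorm v y ^ β * pd i v y)
          = fun i y => rr v β y * pd i v y := by
        funext i y; rw [gradNorm_rpow]
      rw [eF]
      have hr := cd_rr β (hvx x hx) (hne x hx)
      have q : ∀ i j, ContinuousAt (pd i (fun y => rr v β y * pd j v y)) x := fun i j =>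
        (cd_pd i (hr.mul (cd_pd j (hvx x hx)))).continuousAt
      unfold jdet
      exact (((q 0 0).mul (q 1 1)).sub ((q 1 0).mul (q 0 1))).neg
  have hD := (D0.1.add D1.1).const_mul 2
  have hHK := hH.const_mul (4 * (1 + 1/(1 + β) + β^2/((p - 1) * (β + 1))))
  have M := setIntegral_mono_on (s := Ω) (μ := volume) hJ.integrableOn
    (hD.add hHK).integrableOn hΩ.measurableSet
    (fun x hx => pointwise β p hp hβ (hvx x hx) (hne x hx) hφ.1.contDiffAt (hpde x hx))
  refine M.trans (le_of_eq ?_)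
  rw [integral_add' hD.integrableOn hHK.integrableOn, integral_const_mul, integral_const_mul]
  simp only [Pi.add_apply]
  rw [integral_add D0.1.integrableOn D1.1.integrableOn, D0.2, D1.2]
  ring
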